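/- arXiv:math/0610561 — 8 statements merged into one kernel-verified Lean document; each statement's English description precedes it below -/
import Mathlib

section
/- Let W be a type, K a finite type, and F : K × W → ℝ. Suppose g : W → K satisfies F(g(w), w) ≤ F(k, w) for all k ∈ K, w ∈ W, and h : K → W satisfies that h(k) is the unique minimizer of F(k, ·). Define the iteration w_{t+1} = h(g(w_t)) from an arbitrary w_0 ∈ W. Then the iteration converges in a finite number of steps to a fixed point: there exists T ≤ |K| + 1 such that w_{t+1} = w_t for all t ≥ T. -/
/-- Convergence of batch clustering in finitely many steps: with a finite set `K` of
hidden assignments, an optimal-assignment map `g` and an optimal-prototype map `h`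
whose value `h(k)` is the unique minimizer of `F(k, ·)`, the iteration
`w_{t+1} = h(g(w_t))` reaches a fixed point after at most `|K| + 1` steps. -/
theorem stmt_7 (W K : Type*) [Fintype K] (F : K × W → ℝ)
    (g : W → K) (hg : ∀ (k : K) (w : W), F (g w, w) ≤ F (k, w))
    (h : K → W) (hh : ∀ (k : K) (w : W), F (k, h k) ≤ F (k, w))
    (huniq : ∀ (k : K) (w : W), F (k, h k) = F (k, w) → w = h k)
    (seq : ℕ → W) (hseq : ∀ t, seq (t + 1) = h (g (seq t))) :
    ∃ T ≤ Fintype.card K + 1, ∀ t ≥ T, seq (t + 1) = seq t := by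
  have hE : ∀ t, F (g (seq (t+1)), seq (t+1)) ≤ F (g (seq t), seq (t+1)) := fun t => hg _ _
  have hE2 : ∀ t, F (g (seq t), seq (t+1)) ≤ F (g (seq t), seq t) := fun t => by
    rw [hseq t]; exact hh _ _
  have hanti : Antitone (fun t => F (g (seq t), seq t)) :=
    antitone_nat_of_succ_le fun t => (hE t).trans (hE2 t)
  obtain ⟨i, j, hij, hk⟩ := Fintype.exists_ne_map_eq_of_card_lt
    (fun i : Fin (Fintype.card K + 1) => g (seq i)) (by simp)
  have key : ∀ a b : ℕ, a < b → a < Fintype.card K + 1 → g (seq a) = g (seq b) →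
      ∃ T ≤ Fintype.card K + 1, ∀ t ≥ T, seq (t + 1) = seq t := by
    intro a b hab ha hgab
    have h1 : seq (a+1) = seq (b+1) := by rw [hseq, hseq, hgab]
    have h2 : F (g (seq (b+1)), seq (b+1)) ≤ F (g (seq (a+1+1)), seq (a+1+1)) :=
      hanti (show a+1+1 ≤ b+1 by omega)
    rw [← h1] at h2
    have h3 : seq (a+1) = h (g (seq (a+1))) := by
      apply huniq
      rw [← hseq]
      exact le_antisymm (hE2 _) (h2.trans (hE _))
    refine ⟨a+1, ha, fun t ht => ?_⟩
    induction t, ht using Nat.le_induction with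
    | base => rw [hseq (a+1)]; exact h3.symm
    | succ n hn ih => rw [hseq (n+1), ih, ← hseq n, ih]
  rcases lt_or_gt_of_ne (fun e => hij (Fin.ext e) : (i:ℕ) ≠ j) with hl | hl
  · exact key i j hl i.2 hk
  · exact key j i hl j.2 hk.symm
end

section
/- Let x^1, …, x^p ∈ ℝ^m be data points and w^1, …, w^n ∈ ℝ^m prototypes. For each j let c_j ∈ {1,…,n} be any index minimizing i ↦ ‖x^j − w^i‖², and suppose each class R_i = { j : c_j = i } is nonempty. Define the batch k-means update w'^i = (Σ_{j ∈ R_i} x^j) / |R_i|, and for each j let c'_j be any index minimizing i ↦ ‖x^j − w'^i‖². Then Σ_{j=1}^p ‖x^j − w'^{c'_j}‖² ≤ Σ_{j=1}^p ‖x^j − w^{c_j}‖²; i.e. one step of Batch k-means does not increase the quantization error. -/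
/-- One step of Batch k-means does not increase the quantization error: if `c` assigns
each data point to a closest prototype of `w`, each class is nonempty, `w'` is obtained
by replacing each prototype by the mean of its class, and `c'` assigns each data point
to a closest prototype of `w'`, then the new quantization error is at most the old
one. -/
theorem stmt_8 (m p n : ℕ) (x : Fin p → EuclideanSpace ℝ (Fin m))
    (w : Fin n → EuclideanSpace ℝ (Fin m))
    (c : Fin p → Fin n)
    (hc : ∀ j i, ‖x j - w (c j)‖ ^ 2 ≤ ‖x j - w i‖ ^ 2)
    (hne : ∀ i, ∃ j, c j = i)
    (w' : Fin n → EuclideanSpace ℝ (Fin m))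
    (hw' : ∀ i, w' i =
      ((Finset.univ.filter (fun j => c j = i)).card : ℝ)⁻¹ •
        ∑ j ∈ Finset.univ.filter (fun j => c j = i), x j)
    (c' : Fin p → Fin n)
    (hc' : ∀ j i, ‖x j - w' (c' j)‖ ^ 2 ≤ ‖x j - w' i‖ ^ 2) :
    ∑ j, ‖x j - w' (c' j)‖ ^ 2 ≤ ∑ j, ‖x j - w (c j)‖ ^ 2 := by
  refine (Finset.sum_le_sum (fun j _ => hc' j (c j))).trans ?_
  rw [← Finset.sum_fiberwise Finset.univ c (fun j => ‖x j - w' (c j)‖ ^ 2),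
    ← Finset.sum_fiberwise Finset.univ c (fun j => ‖x j - w (c j)‖ ^ 2)]
  refine Finset.sum_le_sum (fun i _ => ?_)
  have hpos : ((Finset.univ.filter (fun j => c j = i)).card : ℝ) ≠ 0 := by
    obtain ⟨j, hj⟩ := hne i
    have : 0 < (Finset.univ.filter (fun j => c j = i)).card :=
      Finset.card_pos.mpr ⟨j, by simp [hj]⟩
    exact_mod_cast this.ne'
  have hzero : ∑ j ∈ Finset.univ.filter (fun j => c j = i), (x j - w' i) = 0 := by
    rw [Finset.sum_sub_distrib, Finset.sum_const, hw' i, ← Nat.cast_smul_eq_nsmul ℝ,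
      smul_smul, mul_inv_cancel₀ hpos, one_smul, sub_self]
  have hinner : ∑ j ∈ Finset.univ.filter (fun j => c j = i),
      2 * inner ℝ (x j - w' i) (w' i - w i) = 0 := by
    rw [← Finset.mul_sum, ← sum_inner, hzero, inner_zero_left, mul_zero]
  have key : ∑ j ∈ Finset.univ.filter (fun j => c j = i), ‖x j - w' (c j)‖ ^ 2
      = ∑ j ∈ Finset.univ.filter (fun j => c j = i),
        (‖x j - w' (c j)‖ ^ 2 + 2 * inner ℝ (x j - w' i) (w' i - w i)) := by
    rw [Finset.sum_add_distrib, hinner, add_zero]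
  rw [key]
  refine Finset.sum_le_sum (fun j hj => ?_)
  have hji : c j = i := by simpa using hj
  rw [hji]
  have h := norm_add_sq_real (x j - w' i) (w' i - w i)
  rw [sub_add_sub_cancel] at h
  rw [h]
  exact le_add_of_nonneg_right (sq_nonneg _)
end

section
/- Let x^1, …, x^p ∈ ℝ^m be data points, w^1, …, w^n ∈ ℝ^m prototypes, λ > 0, and h_λ(t) = exp(−t/λ). For each j let σ_j be a permutation of {0,…,n−1} minimizing σ ↦ Σ_{i=1}^n h_λ(σ(i)) · ‖x^j − w^i‖² over all permutations. Define the Batch NG update w'^i = (Σ_{j=1}^p h_λ(σ_j(i)) x^j) / (Σ_{j=1}^p h_λ(σ_j(i))), and for each j let σ'_j be a permutation minimizing σ ↦ Σ_i h_λ(σ(i)) ‖x^j − w'^i‖². Then Σ_{i=1}^n Σ_{j=1}^p h_λ(σ'_j(i)) · ‖x^j − w'^i‖² ≤ Σ_{i=1}^n Σ_{j=1}^p h_λ(σ_j(i)) · ‖x^j − w^i‖²; i.e. one step of Batch NG does not increase the NG cost. -/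
theorem weighted_mean_le {E : Type*} [NormedAddCommGroup E] [InnerProductSpace ℝ E] {p : ℕ}
    (c : Fin p → ℝ) (hc : ∀ j, 0 < c j) (x : Fin p → E) (u v : E)
    (hv : v = (∑ j, c j)⁻¹ • ∑ j, c j • x j) :
    ∑ j, c j * ‖x j - v‖ ^ 2 ≤ ∑ j, c j * ‖x j - u‖ ^ 2 := by
  rcases Nat.eq_zero_or_pos p with hp | hp
  · subst hp
    simp
  have hne : (Finset.univ : Finset (Fin p)).Nonempty := ⟨⟨0, hp⟩, Finset.mem_univ _⟩
  have hS : 0 < ∑ j, c j := Finset.sum_pos (fun j _ => hc j) hne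
  have h0 : ∑ j, c j • (x j - v) = 0 := by
    simp only [smul_sub, Finset.sum_sub_distrib]
    rw [← Finset.sum_smul, hv, smul_smul, mul_inv_cancel₀ hS.ne', one_smul, sub_self]
  have h1 : ∑ j, c j * inner ℝ (x j - v) (v - u) = 0 := by
    have h2 : inner ℝ (∑ j, c j • (x j - v)) (v - u) = 0 := by
      rw [h0, inner_zero_left]
    rw [sum_inner] at h2
    simpa only [real_inner_smul_left] using h2
  have h3 : ∀ j, c j * ‖x j - u‖ ^ 2 = c j * ‖x j - v‖ ^ 2
      + 2 * (c j * inner ℝ (x j - v) (v - u)) + c j * ‖v - u‖ ^ 2 := by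
    intro j
    rw [← sub_add_sub_cancel (x j) v u, norm_add_sq_real]
    ring
  rw [Finset.sum_congr rfl (fun j _ => h3 j), Finset.sum_add_distrib, Finset.sum_add_distrib,
    ← Finset.mul_sum, h1]
  have h4 : 0 ≤ ∑ j, c j * ‖v - u‖ ^ 2 :=
    Finset.sum_nonneg (fun j _ => mul_nonneg (hc j).le (sq_nonneg _))
  linarith

/-- One step of Batch NG does not increase the NG cost: if for each data point `x^j` the
permutation `σ_j` minimizes `σ ↦ Σ_i h_λ(σ(i))·‖x^j − w^i‖²` over all permutations,
`w'` is the Batch NG update given by the `h_λ`-weighted means, and `σ'_j` minimizes the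
corresponding sum for `w'`, then the new NG cost is at most the old one. -/
theorem stmt_9 (m p n : ℕ) (x : Fin p → EuclideanSpace ℝ (Fin m))
    (w : Fin n → EuclideanSpace ℝ (Fin m)) (lam : ℝ) (hlam : 0 < lam)
    (σ : Fin p → Equiv.Perm (Fin n))
    (hσ : ∀ (j : Fin p) (τ : Equiv.Perm (Fin n)),
      ∑ i, Real.exp (-((σ j i : ℕ) : ℝ) / lam) * ‖x j - w i‖ ^ 2 ≤
      ∑ i, Real.exp (-((τ i : ℕ) : ℝ) / lam) * ‖x j - w i‖ ^ 2)
    (w' : Fin n → EuclideanSpace ℝ (Fin m))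
    (hw' : ∀ i, w' i =
      (∑ j, Real.exp (-((σ j i : ℕ) : ℝ) / lam))⁻¹ •
        ∑ j, Real.exp (-((σ j i : ℕ) : ℝ) / lam) • x j)
    (σ' : Fin p → Equiv.Perm (Fin n))
    (hσ' : ∀ (j : Fin p) (τ : Equiv.Perm (Fin n)),
      ∑ i, Real.exp (-((σ' j i : ℕ) : ℝ) / lam) * ‖x j - w' i‖ ^ 2 ≤
      ∑ i, Real.exp (-((τ i : ℕ) : ℝ) / lam) * ‖x j - w' i‖ ^ 2) :
    ∑ i, ∑ j, Real.exp (-((σ' j i : ℕ) : ℝ) / lam) * ‖x j - w' i‖ ^ 2 ≤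
    ∑ i, ∑ j, Real.exp (-((σ j i : ℕ) : ℝ) / lam) * ‖x j - w i‖ ^ 2 := by
  calc _ = ∑ j, ∑ i, Real.exp (-((σ' j i : ℕ) : ℝ) / lam) * ‖x j - w' i‖ ^ 2 :=
        Finset.sum_comm
    _ ≤ ∑ j, ∑ i, Real.exp (-((σ j i : ℕ) : ℝ) / lam) * ‖x j - w' i‖ ^ 2 :=
        Finset.sum_le_sum (fun j _ => hσ' j (σ j))
    _ = ∑ i, ∑ j, Real.exp (-((σ j i : ℕ) : ℝ) / lam) * ‖x j - w' i‖ ^ 2 :=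
        Finset.sum_comm
    _ ≤ _ := Finset.sum_le_sum (fun i _ =>
        weighted_mean_le (fun j => Real.exp (-((σ j i : ℕ) : ℝ) / lam))
          (fun j => Real.exp_pos _) x (w i) (w' i) (hw' i))
end

section
/- Let x^1, …, x^p ∈ ℝ^m, λ > 0, h_λ(t) = exp(−t/λ), and nd : {1,…,n} × {1,…,n} → ℝ≥0 a fixed neighborhood distance. For prototypes w = (w^1,…,w^n) and each j, let c_j be any index i minimizing Σ_l h_λ(nd(i,l)) ‖x^j − w^l‖². Suppose Σ_j h_λ(nd(c_j,l)) > 0 for all l, define the Batch SOM update w'^l = (Σ_j h_λ(nd(c_j,l)) x^j)/(Σ_j h_λ(nd(c_j,l))), and let c'_j be any index i minimizing Σ_l h_λ(nd(i,l)) ‖x^j − w'^l‖². Then Σ_j Σ_l h_λ(nd(c'_j,l)) ‖x^j − w'^l‖² ≤ Σ_j Σ_l h_λ(nd(c_j,l)) ‖x^j − w^l‖²; i.e. one step of Batch SOM does not increase Heskes' SOM cost. -/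
lemma weighted_mean_min {E ι : Type*} [NormedAddCommGroup E] [InnerProductSpace ℝ E] [Fintype ι]
    (a : ι → ℝ) (x : ι → E) (h : 0 < ∑ j, a j) (u v : E)
    (hu : u = (∑ j, a j)⁻¹ • ∑ j, a j • x j) :
    ∑ j, a j * ‖x j - u‖ ^ 2 ≤ ∑ j, a j * ‖x j - v‖ ^ 2 := by
  have h0 : ∑ j, a j • (x j - u) = 0 := by
    simp only [smul_sub, Finset.sum_sub_distrib, ← Finset.sum_smul]
    rw [hu, smul_inv_smul₀ h.ne', sub_self]
  have h1 : ∀ j, a j * ‖x j - v‖ ^ 2 =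
      a j * ‖x j - u‖ ^ 2 + 2 * inner ℝ (a j • (x j - u)) (u - v) + a j * ‖u - v‖ ^ 2 := by
    intro j
    have h2 : x j - v = (x j - u) + (u - v) := by abel
    rw [h2, norm_add_sq_real, real_inner_smul_left]
    ring
  rw [Finset.sum_congr rfl fun j _ => h1 j, Finset.sum_add_distrib, Finset.sum_add_distrib,
    ← Finset.mul_sum, ← sum_inner, h0, inner_zero_left, ← Finset.sum_mul]
  have := mul_nonneg h.le (sq_nonneg ‖u - v‖)
  linarith

/-- One step of Batch SOM (in Heskes' formulation) does not increase the SOM cost: if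
`c_j` is a winner for `x^j` w.r.t. the averaged distances for prototypes `w`, `w'` is the
Batch SOM update given by the weighted means, and `c'_j` is a winner w.r.t. `w'`, then
the new cost is at most the old one. -/
theorem stmt_11 (m p n : ℕ) (x : Fin p → EuclideanSpace ℝ (Fin m))
    (w : Fin n → EuclideanSpace ℝ (Fin m)) (lam : ℝ) (hlam : 0 < lam)
    (nd : Fin n → Fin n → ℝ) (hnd : ∀ i l, 0 ≤ nd i l)
    (c : Fin p → Fin n)
    (hc : ∀ j i, ∑ l, Real.exp (-(nd (c j) l) / lam) * ‖x j - w l‖ ^ 2 ≤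
      ∑ l, Real.exp (-(nd i l) / lam) * ‖x j - w l‖ ^ 2)
    (hpos : ∀ l, 0 < ∑ j, Real.exp (-(nd (c j) l) / lam))
    (w' : Fin n → EuclideanSpace ℝ (Fin m))
    (hw' : ∀ l, w' l =
      (∑ j, Real.exp (-(nd (c j) l) / lam))⁻¹ •
        ∑ j, Real.exp (-(nd (c j) l) / lam) • x j)
    (c' : Fin p → Fin n)
    (hc' : ∀ j i, ∑ l, Real.exp (-(nd (c' j) l) / lam) * ‖x j - w' l‖ ^ 2 ≤
      ∑ l, Real.exp (-(nd i l) / lam) * ‖x j - w' l‖ ^ 2) :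
    ∑ j, ∑ l, Real.exp (-(nd (c' j) l) / lam) * ‖x j - w' l‖ ^ 2 ≤
    ∑ j, ∑ l, Real.exp (-(nd (c j) l) / lam) * ‖x j - w l‖ ^ 2 := by
  refine (Finset.sum_le_sum fun j _ => hc' j (c j)).trans ?_
  rw [Finset.sum_comm, Finset.sum_comm (f := fun j l => _ * ‖x j - w l‖ ^ 2)]
  exact Finset.sum_le_sum fun l _ => weighted_mean_min _ x (hpos l) _ _ (hw' l)
end

section
/- Let x^1, …, x^p ∈ ℝ^m, λ > 0, h_λ(t) = exp(−t/λ), and let w* = (w*^1,…,w*^n) ∈ (ℝ^m)^n be prototypes such that for every j the squared distances ‖x^j − w*^i‖² (i = 1,…,n) are pairwise distinct, and such that w* is a fixed point of Batch NG, i.e. w*^i = (Σ_j h_λ(k_{ij}) x^j)/(Σ_j h_λ(k_{ij})) where k_{ij} = k_i(x^j, w*). Then w* is a local minimum of the NG cost E_NG(w) = Σ_i Σ_j h_λ(k_i(x^j,w)) ‖x^j − w^i‖²: there is a neighborhood U of w* in (ℝ^m)^n with E_NG(w*) ≤ E_NG(w) for all w ∈ U. -/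
/-- The rank of prototype `w i` with respect to the point `x`: the number of prototypes
strictly closer to `x` in squared Euclidean distance. -/
noncomputable def ngRank {m n : ℕ} (x : EuclideanSpace ℝ (Fin m))
    (w : Fin n → EuclideanSpace ℝ (Fin m)) (i : Fin n) : ℕ :=
  (Finset.univ.filter (fun l : Fin n => ‖x - w l‖ ^ 2 < ‖x - w i‖ ^ 2)).card

/-- The weighted mean minimizes the weighted sum of squared distances. -/
theorem weighted_mean_min_s13 {m p : ℕ} (x : Fin p → EuclideanSpace ℝ (Fin m)) (a : Fin p → ℝ)
    (ha : ∀ j, 0 < a j) (c v : EuclideanSpace ℝ (Fin m))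
    (hc : c = (∑ j, a j)⁻¹ • ∑ j, a j • x j) :
    ∑ j, a j * ‖x j - c‖ ^ 2 ≤ ∑ j, a j * ‖x j - v‖ ^ 2 := by
  rcases Nat.eq_zero_or_pos p with hp | hp
  · subst hp
    simp
  have hne : (∑ j, a j) ≠ 0 :=
    (Finset.sum_pos (fun j _ => ha j) ⟨⟨0, hp⟩, Finset.mem_univ _⟩).ne'
  have h0 : ∑ j, a j • (x j - c) = 0 := by
    simp only [smul_sub, Finset.sum_sub_distrib, ← Finset.sum_smul]
    rw [hc, smul_inv_smul₀ hne, sub_self]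
  have h1 : ∑ j, a j * inner ℝ (x j - c) (c - v) = 0 := by
    have : ∑ j, a j * inner ℝ (x j - c) (c - v) = inner ℝ (∑ j, a j • (x j - c)) (c - v) := by
      rw [sum_inner]
      simp only [real_inner_smul_left]
    rw [this, h0, inner_zero_left]
  have h2 : ∀ j, a j * ‖x j - v‖ ^ 2 = a j * ‖x j - c‖ ^ 2
      + 2 * (a j * inner ℝ (x j - c) (c - v)) + a j * ‖c - v‖ ^ 2 := by
    intro j
    have : x j - v = (x j - c) + (c - v) := by abel
    rw [this, norm_add_sq_real]
    ring
  simp only [h2, Finset.sum_add_distrib, ← Finset.mul_sum, h1]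
  have h3 : 0 ≤ ∑ j, a j * ‖c - v‖ ^ 2 :=
    Finset.sum_nonneg fun j _ => mul_nonneg (ha j).le (sq_nonneg _)
  linarith

/-- Ranks are locally constant where the distances are pairwise distinct. -/
theorem eventually_rank_eq {m n : ℕ} (x : EuclideanSpace ℝ (Fin m))
    (wstar : Fin n → EuclideanSpace ℝ (Fin m))
    (hdist : ∀ (i i' : Fin n), i ≠ i' → ‖x - wstar i‖ ^ 2 ≠ ‖x - wstar i'‖ ^ 2) :
    ∀ᶠ w in nhds wstar, ∀ i, ngRank x w i = ngRank x wstar i := by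
  have hcont : ∀ i : Fin n, Continuous
      (fun w : Fin n → EuclideanSpace ℝ (Fin m) => ‖x - w i‖ ^ 2) := by
    intro i
    fun_prop
  have key : ∀ᶠ w in nhds wstar, ∀ l i : Fin n,
      (‖x - w l‖ ^ 2 < ‖x - w i‖ ^ 2 ↔ ‖x - wstar l‖ ^ 2 < ‖x - wstar i‖ ^ 2) := by
    rw [Filter.eventually_all]
    intro l
    rw [Filter.eventually_all]
    intro i
    by_cases hli : l = i
    · subst hli
      simp
    rcases lt_or_gt_of_ne (hdist l i hli) with h | h
    · filter_upwards [(hcont l).continuousAt.eventually_lt (hcont i).continuousAt h] with w hw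
      exact iff_of_true hw h
    · filter_upwards [(hcont i).continuousAt.eventually_lt (hcont l).continuousAt h] with w hw
      exact iff_of_false hw.not_gt h.not_gt
  filter_upwards [key] with w hw i
  unfold ngRank
  simp only [hw]

/-- A fixed point `w*` of Batch NG at which, for every data point, the squared distances
to the prototypes are pairwise distinct, is a local minimum of the NG cost
`E_NG(w) = Σ_i Σ_j h_λ(k_i(x^j,w))·‖x^j − w^i‖²`. -/
theorem stmt_13 (m p n : ℕ) (x : Fin p → EuclideanSpace ℝ (Fin m))
    (lam : ℝ) (hlam : 0 < lam)
    (wstar : Fin n → EuclideanSpace ℝ (Fin m))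
    (hdist : ∀ (j : Fin p) (i i' : Fin n), i ≠ i' →
      ‖x j - wstar i‖ ^ 2 ≠ ‖x j - wstar i'‖ ^ 2)
    (hfix : ∀ i, wstar i =
      (∑ j, Real.exp (-(ngRank (x j) wstar i : ℝ) / lam))⁻¹ •
        ∑ j, Real.exp (-(ngRank (x j) wstar i : ℝ) / lam) • x j) :
    ∃ U ∈ nhds wstar, ∀ w ∈ U,
      ∑ i, ∑ j, Real.exp (-(ngRank (x j) wstar i : ℝ) / lam) * ‖x j - wstar i‖ ^ 2 ≤
      ∑ i, ∑ j, Real.exp (-(ngRank (x j) w i : ℝ) / lam) * ‖x j - w i‖ ^ 2 := by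
  refine ⟨{w | ∀ j i, ngRank (x j) w i = ngRank (x j) wstar i},
    Filter.eventually_all.2 fun j => eventually_rank_eq (x j) wstar (hdist j), ?_⟩
  intro w hw
  simp only [Set.mem_setOf_eq] at hw
  simp only [hw]
  exact Finset.sum_le_sum fun i _ =>
    weighted_mean_min_s13 x _ (fun j => Real.exp_pos _) _ _ (hfix i)
end

section
/- Let x^1, …, x^p ∈ ℝ^m and let w* = (w*^1,…,w*^n) ∈ (ℝ^m)^n be prototypes such that for every j there is a unique index I(x^j) minimizing i ↦ ‖x^j − w*^i‖², each receptive field R_i = { j : I(x^j) = i } is nonempty, and w* is a fixed point of Batch k-means, i.e. w*^i = (Σ_{j ∈ R_i} x^j)/|R_i| for all i. Then w* is a local minimum of the quantization error E(w) = Σ_j min_i ‖x^j − w^i‖²: there is a neighborhood U of w* in (ℝ^m)^n with E(w*) ≤ E(w) for all w ∈ U. -/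
/-- A fixed point `w*` of Batch k-means at which every data point has a unique closest
prototype and every receptive field is nonempty is a local minimum of the quantization
error `E(w) = Σ_j min_i ‖x^j − w^i‖²`. -/
theorem stmt_14 (m p n : ℕ) (x : Fin p → EuclideanSpace ℝ (Fin m))
    (wstar : Fin n → EuclideanSpace ℝ (Fin m))
    (I : Fin p → Fin n)
    (hwin : ∀ j i, i ≠ I j → ‖x j - wstar (I j)‖ ^ 2 < ‖x j - wstar i‖ ^ 2)
    (hne : ∀ i, ∃ j, I j = i)
    (hfix : ∀ i, wstar i =
      ((Finset.univ.filter (fun j => I j = i)).card : ℝ)⁻¹ •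
        ∑ j ∈ Finset.univ.filter (fun j => I j = i), x j) :
    ∃ U ∈ nhds wstar, ∀ w ∈ U,
      ∑ j, (⨅ i : Fin n, ‖x j - wstar i‖ ^ 2) ≤ ∑ j, ⨅ i : Fin n, ‖x j - w i‖ ^ 2 := by
  classical
  have key : ∀ w : Fin n → EuclideanSpace ℝ (Fin m),
      (∀ j i, i ≠ I j → ‖x j - w (I j)‖ ^ 2 < ‖x j - w i‖ ^ 2) →
      ∀ j, (⨅ i : Fin n, ‖x j - w i‖ ^ 2) = ‖x j - w (I j)‖ ^ 2 := by
    intro w hw j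
    haveI : Nonempty (Fin n) := ⟨I j⟩
    apply le_antisymm
    · exact ciInf_le (Set.finite_range _).bddBelow (I j)
    · apply le_ciInf
      intro i
      by_cases h : i = I j
      · rw [h]
      · exact (hw j i h).le
  refine ⟨{w | ∀ j i, i ≠ I j → ‖x j - w (I j)‖ ^ 2 < ‖x j - w i‖ ^ 2}, ?_, ?_⟩
  · have : ∀ᶠ w in nhds wstar, ∀ j i, i ≠ I j →
        ‖x j - w (I j)‖ ^ 2 < ‖x j - w i‖ ^ 2 := by
      rw [Filter.eventually_all]
      intro j
      rw [Filter.eventually_all]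
      intro i
      by_cases h : i = I j
      · exact Filter.Eventually.of_forall fun w h' => absurd h h'
      · have h1 : Continuous fun w : Fin n → EuclideanSpace ℝ (Fin m) =>
            ‖x j - w (I j)‖ ^ 2 := by fun_prop
        have h2 : Continuous fun w : Fin n → EuclideanSpace ℝ (Fin m) =>
            ‖x j - w i‖ ^ 2 := by fun_prop
        filter_upwards [(isOpen_lt h1 h2).mem_nhds (hwin j i h)] with w hw _
        exact hw
    exact this
  · intro w hw
    rw [Finset.sum_congr rfl fun j _ => key wstar hwin j,
      Finset.sum_congr rfl fun j _ => key w hw j]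
    have hz : ∀ i, ∑ j ∈ Finset.univ.filter (fun j => I j = i), (x j - wstar i) = 0 := by
      intro i
      obtain ⟨j0, hj0⟩ := hne i
      have hc : ((Finset.univ.filter (fun j => I j = i)).card : ℝ) ≠ 0 := by
        have : 0 < (Finset.univ.filter (fun j => I j = i)).card :=
          Finset.card_pos.mpr ⟨j0, by simp [hj0]⟩
        exact_mod_cast this.ne'
      rw [Finset.sum_sub_distrib, Finset.sum_const, ← Nat.cast_smul_eq_nsmul ℝ, sub_eq_zero]
      conv_rhs => rw [hfix i]
      rw [smul_smul, mul_inv_cancel₀ hc, one_smul]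
    have hcross : ∑ j, inner ℝ (x j - wstar (I j)) (wstar (I j) - w (I j)) = 0 := by
      rw [← Finset.sum_fiberwise Finset.univ I]
      apply Finset.sum_eq_zero
      intro i _
      have : ∀ j ∈ Finset.univ.filter (fun j => I j = i),
          inner ℝ (x j - wstar (I j)) (wstar (I j) - w (I j))
            = inner ℝ (x j - wstar i) (wstar i - w i) := by
        intro j hj
        rw [(Finset.mem_filter.mp hj).2]
      rw [Finset.sum_congr rfl this, ← sum_inner, hz i, inner_zero_left]
    have hle : ∑ j, (‖x j - wstar (I j)‖ ^ 2
        + 2 * inner ℝ (x j - wstar (I j)) (wstar (I j) - w (I j)))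
        ≤ ∑ j, ‖x j - w (I j)‖ ^ 2 := by
      apply Finset.sum_le_sum
      intro j _
      have h := norm_add_sq_real (x j - wstar (I j)) (wstar (I j) - w (I j))
      rw [sub_add_sub_cancel] at h
      nlinarith [sq_nonneg ‖wstar (I j) - w (I j)‖]
    rw [Finset.sum_add_distrib, ← Finset.mul_sum, hcross] at hle
    linarith
end

section
/- Let d : {1,…,p} × {1,…,p} → ℝ be an arbitrary dissimilarity matrix. Let prototypes be given by indices l_1, …, l_n ∈ {1,…,p} (so prototype i is the data point x^{l_i}). For each j let c_j ∈ {1,…,n} be any index minimizing i ↦ d(j, l_i), and define the Median k-means update by choosing, for each i, l'_i ∈ {1,…,p} minimizing l ↦ Σ_{j : c_j = i} d(j, l) (the generalized median of the receptive field). For each j let c'_j be any index minimizing i ↦ d(j, l'_i). Then Σ_{j=1}^p d(j, l'_{c'_j}) ≤ Σ_{j=1}^p d(j, l_{c_j}); i.e. one step of Median k-means does not increase the quantization cost. -/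
/-- One step of Median k-means does not increase the quantization cost: given a
dissimilarity matrix `d`, prototypes at data points `l_1, …, l_n`, winner assignments
`c_j`, the generalized-median update `l'` and new winner assignments `c'_j`, the new
cost `Σ_j d(j, l'_{c'_j})` is at most the old cost `Σ_j d(j, l_{c_j})`. -/
theorem stmt_15 (p n : ℕ) (d : Fin p → Fin p → ℝ)
    (l : Fin n → Fin p) (c : Fin p → Fin n)
    (hc : ∀ j i, d j (l (c j)) ≤ d j (l i))
    (l' : Fin n → Fin p)
    (hl' : ∀ (i : Fin n) (q : Fin p),
      ∑ j ∈ Finset.univ.filter (fun j => c j = i), d j (l' i) ≤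
      ∑ j ∈ Finset.univ.filter (fun j => c j = i), d j q)
    (c' : Fin p → Fin n)
    (hc' : ∀ j i, d j (l' (c' j)) ≤ d j (l' i)) :
    ∑ j, d j (l' (c' j)) ≤ ∑ j, d j (l (c j)) := by
  have key : ∀ m : Fin n → Fin p, ∑ j, d j (m (c j)) =
      ∑ i, ∑ j ∈ Finset.univ.filter (fun j => c j = i), d j (m i) := by
    intro m
    rw [← Finset.sum_fiberwise Finset.univ c]
    refine Finset.sum_congr rfl fun i _ => Finset.sum_congr rfl fun j hj => ?_
    rw [(Finset.mem_filter.mp hj).2]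
  calc ∑ j, d j (l' (c' j)) ≤ ∑ j, d j (l' (c j)) :=
        Finset.sum_le_sum fun j _ => hc' j (c j)
    _ ≤ ∑ j, d j (l (c j)) := by
        rw [key l', key l]
        exact Finset.sum_le_sum fun i _ => hl' i (l i)
end

section
/- Let d : {1,…,p} × {1,…,p} → ℝ be an arbitrary dissimilarity matrix, λ > 0, and h_λ(t) = exp(−t/λ). Let prototypes be given by indices l_1, …, l_n ∈ {1,…,p}. For each j let σ_j be a permutation of {0,…,n−1} minimizing σ ↦ Σ_{i=1}^n h_λ(σ(i)) · d(j, l_i) over all permutations. Define the Median NG update by choosing, for each i, l'_i ∈ {1,…,p} minimizing l ↦ Σ_{j=1}^p h_λ(σ_j(i)) · d(j, l). For each j let σ'_j be a permutation minimizing σ ↦ Σ_i h_λ(σ(i)) · d(j, l'_i). Then Σ_{i=1}^n Σ_{j=1}^p h_λ(σ'_j(i)) · d(j, l'_i) ≤ Σ_{i=1}^n Σ_{j=1}^p h_λ(σ_j(i)) · d(j, l_i); i.e. one step of Median NG does not increase the NG cost. -/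
/-- One step of Median NG does not increase the NG cost: given a dissimilarity matrix
`d`, prototypes at data points `l_1, …, l_n`, cost-minimizing permutations `σ_j`, the
generalized-median update `l'` and new cost-minimizing permutations `σ'_j`, the new NG
cost is at most the old one. -/
theorem stmt_16 (p n : ℕ) (d : Fin p → Fin p → ℝ) (lam : ℝ) (hlam : 0 < lam)
    (l : Fin n → Fin p) (σ : Fin p → Equiv.Perm (Fin n))
    (hσ : ∀ (j : Fin p) (τ : Equiv.Perm (Fin n)),
      ∑ i, Real.exp (-((σ j i : ℕ) : ℝ) / lam) * d j (l i) ≤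
      ∑ i, Real.exp (-((τ i : ℕ) : ℝ) / lam) * d j (l i))
    (l' : Fin n → Fin p)
    (hl' : ∀ (i : Fin n) (q : Fin p),
      ∑ j, Real.exp (-((σ j i : ℕ) : ℝ) / lam) * d j (l' i) ≤
      ∑ j, Real.exp (-((σ j i : ℕ) : ℝ) / lam) * d j q)
    (σ' : Fin p → Equiv.Perm (Fin n))
    (hσ' : ∀ (j : Fin p) (τ : Equiv.Perm (Fin n)),
      ∑ i, Real.exp (-((σ' j i : ℕ) : ℝ) / lam) * d j (l' i) ≤
      ∑ i, Real.exp (-((τ i : ℕ) : ℝ) / lam) * d j (l' i)) :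
    ∑ i, ∑ j, Real.exp (-((σ' j i : ℕ) : ℝ) / lam) * d j (l' i) ≤
    ∑ i, ∑ j, Real.exp (-((σ j i : ℕ) : ℝ) / lam) * d j (l i) := by
  refine le_trans ?_ (Finset.sum_le_sum fun i _ => hl' i (l i))
  rw [Finset.sum_comm]
  refine le_trans (Finset.sum_le_sum fun j _ => hσ' j (σ j)) ?_
  rw [Finset.sum_comm]
end
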